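/- Let t : Ω × M(Ω) → [0, +∞] be a lower semicontinuous function such that ∫ t(ω, P) dP(ω) ≤ 1 for every Borel probability measure P on Ω. Then there exists a Borel probability measure N on Ω such that t(ω, N) ≤ 1 for every ω ∈ Ω (a 'neutral' measure for t). -/

import Mathlib

open MeasureTheory
open scoped ENNReal

/-- A finite set `σ` is dominant for the family `r` of rankings if no point strictly exceeds, in
every ranking, the lowest element of `σ`. -/
def Dominant {I V : Type*} (r : I → V → ℕ) (σ : Finset V) : Prop :=
  ∀ y, ∃ i, ∀ x ∈ σ, r i y ≤ r i x

namespace Dominant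

variable {I V : Type*} {r : I → V → ℕ}

theorem mono {σ τ : Finset V} (h : Dominant r σ) (hτ : τ ⊆ σ) : Dominant r τ := fun y => by
  obtain ⟨i, hi⟩ := h y
  exact ⟨i, fun x hx => hi x (hτ hx)⟩

/-- A dominant set with one element fewer than there are rankings, which lies below some point
outside it in all rankings but one, whichever one that is, extends to exactly two dominant sets
by adding one element. -/
theorem card_extensions_eq_two [Fintype I] [Fintype V] [DecidableEq V] [DecidableEq I]
    (hr : ∀ i, Function.Injective (r i)) {τ : Finset V} (hτ : Dominant r τ) (hne : τ.Nonempty)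
    (hcard : τ.card + 1 = Fintype.card I)
    (hM : ∀ k, ∃ y, ∀ l, l ≠ k → ∃ x ∈ τ, r l x < r l y)
    [DecidablePred fun y => y ∉ τ ∧ Dominant r (insert y τ)] :
    (Finset.univ.filter fun y => y ∉ τ ∧ Dominant r (insert y τ)).card = 2 := by
  have hmin : ∀ i, ∃ x ∈ τ, ∀ z ∈ τ, r i x ≤ r i z := fun i => τ.exists_min_image (r i) hne
  choose m hmτ hm using hmin
  have hm_eq : ∀ i, ∀ x ∈ τ, (∀ z ∈ τ, r i x ≤ r i z) → m i = x := fun i x hx h =>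
    hr i (le_antisymm (hm i x hx) (h _ (hmτ i)))
  have hinj : ∀ k, (∀ x ∈ τ, ∃ l, l ≠ k ∧ m l = x) →
      Set.InjOn m (Finset.univ.erase k : Finset I) := by
    intro k hk
    rw [← Finset.card_image_iff]
    have : (Finset.univ.erase k).image m = τ := by
      ext x
      simp only [Finset.mem_image, Finset.mem_erase, Finset.mem_univ, and_true]
      constructor
      · rintro ⟨l, -, rfl⟩; exact hmτ l
      · exact hk x
    rw [this, Finset.card_erase_of_mem (Finset.mem_univ k), Finset.card_univ]
    omega
  obtain ⟨i, -, j, -, hij, hmij⟩ := Finset.exists_ne_map_eq_of_card_lt_of_maps_to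
    (s := (Finset.univ : Finset I)) (t := τ) (by rw [Finset.card_univ]; omega)
    (f := m) (fun i _ => hmτ i)
  have hsurj : ∀ x ∈ τ, ∃ l, m l = x := fun x hx => by
    obtain ⟨l, hl⟩ := hτ x
    exact ⟨l, hm_eq l x hx hl⟩
  have hiinj := hinj i fun x hx => by
    obtain ⟨l, hl⟩ := hsurj x hx
    by_cases h : l = i
    · exact ⟨j, hij.symm, by rw [← hmij, ← h, hl]⟩
    · exact ⟨l, h, hl⟩
  have hjinj := hinj j fun x hx => by
    obtain ⟨l, hl⟩ := hsurj x hx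
    by_cases h : l = j
    · exact ⟨i, hij, by rw [hmij, ← h, hl]⟩
    · exact ⟨l, h, hl⟩
  have hpair : ∀ k l, k ≠ l → m k = m l → (k = i ∨ k = j) := by
    intro k l hkl he
    by_contra! h
    by_cases hl : l = i
    · exact hkl (hjinj (by simp [h.2]) (by simp [hl, hij]) he)
    · exact hkl (hiinj (by simp [h.1]) (by simp [hl]) he)
  have htop : ∀ k, ∃ y, (∀ l, l ≠ k → r l (m l) < r l y) ∧
      ∀ z, (∀ l, l ≠ k → r l (m l) < r l z) → r k z ≤ r k y := by
    intro k
    obtain ⟨y, hy⟩ := hM k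
    obtain ⟨y', hy', hmax⟩ := (Finset.univ.filter fun y => ∀ l, l ≠ k → r l (m l) < r l y)
      |>.exists_max_image (r k) ⟨y, by
        simp only [Finset.mem_filter, Finset.mem_univ, true_and]
        intro l hl
        obtain ⟨x, hx, hxy⟩ := hy l hl
        exact (hm l x hx).trans_lt hxy⟩
    exact ⟨y', by simpa using hy', fun z hz => hmax z (by simpa using hz)⟩
  have hlow : ∀ k y, (∀ l, l ≠ k → r l (m l) < r l y) → ∀ x ∈ τ, r k y ≤ r k x := by
    intro k y hy
    obtain ⟨l, hl⟩ := hτ y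
    by_cases h : l = k
    · exact h ▸ hl
    · exact absurd (hl _ (hmτ l)) (not_le.2 (hy l h))
  have hext : ∀ k k', k ≠ k' → m k = m k' → ∀ y, (∀ l, l ≠ k → r l (m l) < r l y) →
      (∀ z, (∀ l, l ≠ k → r l (m l) < r l z) → r k z ≤ r k y) →
      y ∉ τ ∧ Dominant r (insert y τ) := by
    intro k k' hk hmk y hy hmax
    refine ⟨fun hyτ => ?_, fun z => ?_⟩
    · have : m k = y := hm_eq k y hyτ (hlow k y hy)
      have := hy k' hk.symm
      simp_all
    · by_cases hz : ∀ l, l ≠ k → r l (m l) < r l z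
      · exact ⟨k, by simpa [hmax z hz] using hlow k z hz⟩
      · push Not at hz
        obtain ⟨l, hlk, hl⟩ := hz
        refine ⟨l, ?_⟩
        simp only [Finset.mem_insert, forall_eq_or_imp]
        exact ⟨hl.trans (hy l hlk).le, fun x hx => hl.trans (hm l x hx)⟩
  obtain ⟨a, ha, hamax⟩ := htop i
  obtain ⟨b, hb, hbmax⟩ := htop j
  have hab : a ≠ b := by
    rintro rfl
    obtain ⟨l, hl⟩ := hτ a
    by_cases h : l = i
    · exact absurd (hl _ (hmτ l)) (not_le.2 (hb l (h ▸ hij)))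
    · exact absurd (hl _ (hmτ l)) (not_le.2 (ha l h))
  rw [Finset.card_eq_two]
  refine ⟨a, b, hab, ?_⟩
  ext y
  simp only [Finset.mem_filter, Finset.mem_univ, true_and, Finset.mem_insert,
    Finset.mem_singleton]
  constructor
  · rintro ⟨hyτ, hdom⟩
    obtain ⟨k, hk⟩ := hdom y
    have hown : ∀ x ∈ τ, ∃ l, l ≠ k ∧ m l = x ∧ r l x ≤ r l y := by
      intro x hx
      obtain ⟨l, hl⟩ := hdom x
      refine ⟨l, ?_, hm_eq l x hx fun z hz => hl z (Finset.mem_insert_of_mem hz),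
        hl y (Finset.mem_insert_self _ _)⟩
      rintro rfl
      have := hr l (le_antisymm (hl y (Finset.mem_insert_self _ _))
        (hk x (Finset.mem_insert_of_mem hx)))
      exact hyτ (this ▸ hx)
    have hkinj := hinj k fun x hx => by
      obtain ⟨l, h1, h2, -⟩ := hown x hx
      exact ⟨l, h1, h2⟩
    have hky : ∀ l, l ≠ k → r l (m l) < r l y := by
      intro l hl
      obtain ⟨l', h1, h2, h3⟩ := hown _ (hmτ l)
      obtain rfl : l' = l := hkinj (by simp [h1]) (by simp [hl]) h2
      refine lt_of_le_of_ne h3 fun h => hyτ ?_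
      rw [← hr _ h]
      exact hmτ _
    have hkmax : ∀ z, (∀ l, l ≠ k → r l (m l) < r l z) → r k z ≤ r k y := by
      intro z hz
      obtain ⟨l, hl⟩ := hdom z
      by_cases h : l = k
      · exact h ▸ hl y (Finset.mem_insert_self _ _)
      · exact absurd (hl _ (Finset.mem_insert_of_mem (hmτ l))) (not_le.2 (hz l h))
    have hkij : k = i ∨ k = j := by
      by_contra! h
      exact hij (hkinj (by simp [h.1.symm]) (by simp [h.2.symm]) hmij)
    rcases hkij with rfl | rfl
    · exact Or.inl (hr k (le_antisymm (hamax y hky) (hkmax a ha)))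
    · exact Or.inr (hr k (le_antisymm (hbmax y hky) (hkmax b hb)))
  · rintro (rfl | rfl)
    · exact hext i j hij hmij y ha hamax
    · exact hext j i hij.symm hmij.symm y hb hbmax

end Dominant

/-- **Scarf's lemma**: given rankings with bottom elements `s i`, where the ranking `i` puts all the
`s j` with `j ≠ i` above all other points, every colouring with `s i` of colour `i` admits a
dominant set carrying each colour exactly once. -/
theorem exists_dominant_bijOn {I V : Type*} [Fintype I] [Nonempty I] [Fintype V]
    {r : I → V → ℕ} (hr : ∀ i, Function.Injective (r i)) {s : I → V} {c : V → I}
    (hcs : ∀ i, c (s i) = i) (hbot : ∀ i v, r i (s i) ≤ r i v)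
    (htop : ∀ i j v, i ≠ j → v ∉ Set.range s → r i v < r i (s j))
    (hT : ∃ v, v ∉ Set.range s) :
    ∃ σ : Finset V, Dominant r σ ∧ Set.BijOn c σ Set.univ := by
  classical
  by_contra! hno
  obtain ⟨i₀⟩ := ‹Nonempty I›
  let A : Finset (Finset V × V) := Finset.univ.filter fun p =>
    (Set.InjOn c p.1 ∧ p.1.image c = Finset.univ.erase i₀) ∧ p.2 ∉ p.1 ∧
      Dominant r (insert p.2 p.1)
  have hA : ∀ p, p ∈ A ↔ (Set.InjOn c p.1 ∧ p.1.image c = Finset.univ.erase i₀) ∧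
      p.2 ∉ p.1 ∧ Dominant r (insert p.2 p.1) := fun p => by simp [A]
  have hmem : ∀ {τ : Finset V}, τ.image c = Finset.univ.erase i₀ →
      ∀ i, i ≠ i₀ → ∃ x ∈ τ, c x = i := by
    intro τ h i hi
    have : i ∈ τ.image c := by simp [h, hi]
    simpa using this
  have hne : ∀ {τ : Finset V}, τ.image c = Finset.univ.erase i₀ → ∀ x ∈ τ, c x ≠ i₀ := by
    intro τ h x hx
    have : c x ∈ τ.image c := Finset.mem_image_of_mem c hx
    simpa [h] using this
  have heven : Even A.card := by
    rw [Finset.card_eq_sum_card_image (fun p => insert p.2 p.1) A]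
    refine Finset.even_sum _ fun σ hσ => ?_
    obtain ⟨⟨τ, y⟩, hp, rfl⟩ := Finset.mem_image.1 hσ
    obtain ⟨⟨hinj, himg⟩, hy, hdom⟩ := (hA _).1 hp
    dsimp only at hinj himg hy hdom ⊢
    have hcy : c y ≠ i₀ := by
      intro hcy
      refine hno _ hdom ⟨fun _ _ => Set.mem_univ _, ?_, ?_⟩
      · rw [Finset.coe_insert, Set.injOn_insert (by simpa using hy)]
        refine ⟨hinj, ?_⟩
        rintro ⟨x, hx, hxy⟩
        exact hne himg x hx (hxy.trans hcy)
      · intro i _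
        by_cases hi : i = i₀
        · exact ⟨y, by simp, hcy.trans hi.symm⟩
        · obtain ⟨x, hx, rfl⟩ := hmem himg i hi
          exact ⟨x, by simp [hx], rfl⟩
    obtain ⟨x, hx, hxy⟩ := hmem himg _ hcy
    have hxny : x ≠ y := fun h => hy (h ▸ hx)
    have hfib : (A.filter fun p => insert p.2 p.1 = insert y τ) =
        {(τ, y), ((insert y τ).erase x, x)} := by
      ext ⟨τ', z⟩
      simp only [Finset.mem_filter, hA, Finset.mem_insert, Finset.mem_singleton, Prod.mk.injEq]
      constructor
      · rintro ⟨⟨⟨hinj', himg'⟩, hz, -⟩, he⟩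
        have hτ' : τ' = (insert y τ).erase z := by rw [← he, Finset.erase_insert hz]
        by_cases hzx : z = x
        · exact Or.inr ⟨by rw [hτ', hzx], hzx⟩
        by_cases hzy : z = y
        · exact Or.inl ⟨by rw [hτ', hzy, Finset.erase_insert hy], hzy⟩
        exfalso
        refine hxny (hinj' ?_ ?_ hxy)
        · simp [hτ', Ne.symm hzx, hx]
        · simp [hτ', Ne.symm hzy]
      · rintro (⟨rfl, rfl⟩ | ⟨rfl, rfl⟩)
        · exact ⟨⟨⟨hinj, himg⟩, hy, hdom⟩, rfl⟩
        · have hins : insert z ((insert y τ).erase z) = insert y τ :=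
            Finset.insert_erase (Finset.mem_insert_of_mem hx)
          refine ⟨⟨⟨?_, ?_⟩, by simp, by rw [hins]; exact hdom⟩, hins⟩
          · rw [Finset.erase_insert_of_ne hxny.symm, Finset.coe_insert,
              Set.injOn_insert (by simp [hy])]
            refine ⟨hinj.mono (by simp), ?_⟩
            rintro ⟨w, hw, hwy⟩
            simp only [Finset.coe_erase, Set.mem_sdiff, Finset.mem_coe,
              Set.mem_singleton_iff] at hw
            exact hw.2 (hinj hw.1 hx (hwy.trans hxy.symm))
          · rw [← himg]
            ext i
            simp only [Finset.mem_image, Finset.mem_erase, Finset.mem_insert]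
            constructor
            · rintro ⟨w, ⟨hwz, rfl | hw⟩, rfl⟩
              · exact ⟨z, hx, hxy⟩
              · exact ⟨w, hw, rfl⟩
            · rintro ⟨w, hw, rfl⟩
              by_cases hwz : w = z
              · exact ⟨y, ⟨hxny.symm, Or.inl rfl⟩, by rw [hwz, hxy]⟩
              · exact ⟨w, ⟨hwz, Or.inr hw⟩, rfl⟩
    rw [hfib, Finset.card_pair (by simp [hxny.symm])]
    exact even_two
  let τ₀ : Finset V := (Finset.univ.erase i₀).image s
  have hfst : ∀ τ, (A.filter fun p => p.1 = τ).card =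
      if Set.InjOn c τ ∧ τ.image c = Finset.univ.erase i₀ then
        (Finset.univ.filter fun y => y ∉ τ ∧ Dominant r (insert y τ)).card else 0 := by
    intro τ
    split_ifs with h
    · symm
      refine Finset.card_bij (fun y _ => (τ, y)) ?_ ?_ ?_
      · intro y hy
        simpa [hA, h] using hy
      · simp
      · rintro ⟨τ', y⟩ hy
        obtain ⟨hyA, rfl⟩ := Finset.mem_filter.1 hy
        exact ⟨y, by simpa using ((hA _).1 hyA).2, rfl⟩
    · rw [Finset.card_eq_zero, Finset.filter_eq_empty_iff]
      rintro p hp rfl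
      exact h ((hA p).1 hp).1
  have hsτ₀ : ∀ x, x ∈ τ₀ ↔ ∃ l, l ≠ i₀ ∧ s l = x := fun x => by simp [τ₀]
  have hodd : Odd A.card := by
    rw [Finset.card_eq_sum_card_fiberwise (f := Prod.fst) (s := A) (t := Finset.univ)
      (by simp), ← Finset.add_sum_erase _ _ (Finset.mem_univ τ₀)]
    refine Odd.add_even ?_ (Finset.even_sum _ fun τ hτ => ?_)
    · have hdoor : Set.InjOn c τ₀ ∧ τ₀.image c = Finset.univ.erase i₀ := by
        constructor
        · intro a ha b hb hab
          obtain ⟨l, -, rfl⟩ := (hsτ₀ a).1 ha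
          obtain ⟨l', -, rfl⟩ := (hsτ₀ b).1 hb
          rw [hcs, hcs] at hab
          rw [hab]
        · ext i
          simp [τ₀, hcs]
      rw [hfst, if_pos hdoor]
      obtain ⟨v, hv⟩ := hT
      obtain ⟨w, hw, hwmax⟩ := (Finset.univ.filter fun v => v ∉ Set.range s).exists_max_image
        (r i₀) ⟨v, by simpa using hv⟩
      replace hw : w ∉ Set.range s := (Finset.mem_filter.1 hw).2
      replace hwmax : ∀ z, z ∉ Set.range s → r i₀ z ≤ r i₀ w := fun z hz =>
        hwmax z (Finset.mem_filter.2 ⟨Finset.mem_univ z, hz⟩)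
      have hone : (Finset.univ.filter fun y => y ∉ τ₀ ∧ Dominant r (insert y τ₀)) = {w} := by
        ext y
        simp only [Finset.mem_filter, Finset.mem_univ, true_and, Finset.mem_singleton]
        constructor
        · rintro ⟨hy, hdom⟩
          have hle : ∀ z, z ∉ Set.range s → r i₀ z ≤ r i₀ y := by
            intro z hz
            obtain ⟨l, hl⟩ := hdom z
            by_cases h : l = i₀
            · exact h ▸ hl y (by simp)
            · have := hl (s l) (Finset.mem_insert_of_mem ((hsτ₀ _).2 ⟨l, h, rfl⟩))
              exact absurd ⟨l, hr l (le_antisymm (hbot l z) this)⟩ hz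
          have hys : y ∉ Set.range s := by
            rintro ⟨l, rfl⟩
            by_cases h : l = i₀
            · subst h
              exact hw ⟨l, hr l (le_antisymm (hbot l w) (hle w hw))⟩
            · exact hy ((hsτ₀ _).2 ⟨l, h, rfl⟩)
          exact hr i₀ (le_antisymm (hwmax y hys) (hle w hw))
        · rintro rfl
          refine ⟨fun h => ?_, fun z => ?_⟩
          · obtain ⟨l, -, h⟩ := (hsτ₀ _).1 h
            exact hw ⟨l, h⟩
          · by_cases hz : z ∈ Set.range s
            · obtain ⟨l, rfl⟩ := hz
              exact ⟨l, fun x _ => hbot l x⟩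
            · refine ⟨i₀, ?_⟩
              simp only [Finset.mem_insert, forall_eq_or_imp]
              refine ⟨hwmax z hz, fun x hx => ?_⟩
              obtain ⟨l, hl, rfl⟩ := (hsτ₀ _).1 hx
              exact (htop i₀ l z hl.symm hz).le
      rw [hone, Finset.card_singleton]
      exact odd_one
    · rw [hfst]
      split_ifs with hdoor
      · obtain ⟨hinj, himg⟩ := hdoor
        obtain hdom | hdom := em (Dominant r τ)
        · obtain ⟨x, hx, hxs⟩ : ∃ x ∈ τ, x ∉ Set.range s := by
            by_contra! h
            refine (Finset.mem_erase.1 hτ).1 ?_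
            ext x
            rw [hsτ₀]
            constructor
            · intro hx
              obtain ⟨l, rfl⟩ := h x hx
              exact ⟨l, by simpa [hcs] using hne himg _ hx, rfl⟩
            · rintro ⟨l, hl, rfl⟩
              obtain ⟨x, hx, hxl⟩ := hmem himg l hl
              obtain ⟨l', rfl⟩ := h x hx
              rw [hcs] at hxl
              rwa [← hxl]
          rw [hdom.card_extensions_eq_two hr ⟨x, hx⟩]
          · exact even_two
          · rw [← Finset.card_image_iff.2 hinj, himg,
              Finset.card_erase_of_mem (Finset.mem_univ _), Finset.card_univ]
            have : 0 < Fintype.card I := Fintype.card_pos_iff.2 ⟨i₀⟩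
            omega
          · exact fun k => ⟨s k, fun l hl => ⟨x, hx, htop l k x hl hxs⟩⟩
        · rw [Finset.filter_false_of_mem fun y _ h =>
            hdom (h.2.mono (Finset.subset_insert _ _))]
          simp
      · exact Even.zero
  exact Nat.not_even_iff_odd.2 hodd heven

/-- In any colouring of the lattice points of a dilated simplex, some lattice point `y` is within
bounded distance of points of each of the colours in a set `C` that contains its support. -/
theorem exists_lattice_point_near_colors {I : Type*} [Fintype I] [Nonempty I] (m : ℕ)
    (c : (I → ℕ) → I) :
    ∃ (C : Finset I) (y : I → ℕ), ∑ i, y i = m ∧ (∀ i, i ∉ C → y i = 0) ∧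
      ∀ i ∈ C, ∃ x : I → ℕ, ∑ j, x j = m ∧ c x = i ∧
        ∀ j, x j ≤ y j + Fintype.card I ∧ y j ≤ x j + Fintype.card I := by
  classical
  let T := {x : I → ℕ // x ∈ Finset.piAntidiag Finset.univ m}
  let _ : Fintype T := inferInstanceAs (Fintype {x // x ∈ Finset.piAntidiag Finset.univ m})
  have hTsum : ∀ x : T, ∑ i, x.1 i = m := fun x => (Finset.mem_piAntidiag.1 x.2).1
  have hTmk : ∀ x : I → ℕ, ∑ i, x i = m → x ∈ Finset.piAntidiag Finset.univ m := fun x hx =>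
    Finset.mem_piAntidiag.2 ⟨hx, fun _ _ => Finset.mem_univ _⟩
  let e := Fintype.equivFin (T ⊕ I)
  let K := Fintype.card (T ⊕ I)
  let h : I → T ⊕ I → ℕ := fun i => Sum.elim (fun x => x.1 i + 1) fun j => if j = i then 0 else m + 2
  let r : I → T ⊕ I → ℕ := fun i v => h i v * K + e v
  have hlt : ∀ i v w, h i v < h i w → r i v < r i w := by
    intro i v w hvw
    have h1 : (h i v + 1) * K ≤ h i w * K := Nat.mul_le_mul_right K hvw
    have h2 : (e v : ℕ) < K := (e v).2
    simp only [r]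
    linarith
  have hle : ∀ i v w, r i v ≤ r i w → h i v ≤ h i w := fun i v w hvw =>
    not_lt.1 fun hw => absurd (hlt i w v hw) (not_lt.2 hvw)
  have hr : ∀ i, Function.Injective (r i) := by
    intro i v w hvw
    have h1 := le_antisymm (hle i v w hvw.le) (hle i w v hvw.ge)
    simp only [r, h1, Nat.add_left_cancel_iff] at hvw
    exact e.injective (Fin.ext hvw)
  have hle_m : ∀ (x : T) i, x.1 i ≤ m := fun x i =>
    (Finset.single_le_sum (fun _ _ => Nat.zero_le _) (Finset.mem_univ i)).trans (hTsum x).le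
  have hsingle : ∀ (i₀ : I) (k : ℕ), ∑ i, (if i = i₀ then k else 0) = k := by simp
  obtain ⟨σ, hdom, hσ⟩ := exists_dominant_bijOn hr (s := Sum.inr)
    (c := Sum.elim (fun x => c x.1) id) (fun _ => rfl)
    (by
      intro i v
      by_cases hv : v = Sum.inr i
      · rw [hv]
      · refine (hlt i _ _ ?_).le
        rcases v with x | j
        · simp [h]
        · have : j ≠ i := fun hj => hv (hj ▸ rfl)
          simp [h, this])
    (by
      rintro i j (x | k) hij hv
      · have := hle_m x i
        refine hlt i _ _ ?_
        simp only [h, Sum.elim_inl, Sum.elim_inr, hij.symm, if_false]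
        omega
      · exact absurd ⟨k, rfl⟩ hv)
    ⟨Sum.inl ⟨fun i => if i = Classical.arbitrary I then m else 0, hTmk _ (by simp)⟩, by simp⟩
  let C : Finset I := Finset.univ.filter fun i => Sum.inr i ∉ σ
  have hC : ∀ i, i ∈ C ↔ Sum.inr i ∉ σ := fun i => by simp [C]
  have hcol : ∀ i ∈ C, ∃ x : T, Sum.inl x ∈ σ ∧ c x.1 = i := by
    intro i hi
    obtain ⟨x | j, hx, hxi⟩ := hσ.surjOn (Set.mem_univ i)
    · exact ⟨x, hx, hxi⟩
    · obtain rfl : j = i := hxi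
      exact absurd hx ((hC j).1 hi)
  have hdomT : ∀ y : I → ℕ, ∑ i, y i = m → ∃ i ∈ C, ∀ x : T, Sum.inl x ∈ σ → y i ≤ x.1 i := by
    intro y hy
    obtain ⟨i, hi⟩ := hdom (Sum.inl ⟨y, hTmk y hy⟩)
    refine ⟨i, (hC i).2 fun hiσ => ?_, fun x hx => ?_⟩
    · have := hle _ _ _ (hi _ hiσ)
      simp [h] at this
    · have := hle _ _ _ (hi _ hx)
      simpa [h] using this
  obtain ⟨i₀, hi₀, -⟩ := hdomT _ (hsingle (Classical.arbitrary I) m)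
  let S : Finset T := Finset.univ.filter fun x => Sum.inl x ∈ σ
  have hS : S.Nonempty := by
    obtain ⟨x, hx, -⟩ := hcol i₀ hi₀
    exact ⟨x, by simpa [S] using hx⟩
  have hlow : ∀ i, ∃ k, (∀ x : T, Sum.inl x ∈ σ → k ≤ x.1 i) ∧
      ∃ x : T, Sum.inl x ∈ σ ∧ x.1 i = k := by
    intro i
    obtain ⟨x, hx, hmin⟩ := S.exists_min_image (fun x => x.1 i) hS
    exact ⟨x.1 i, fun z hz => hmin z (by simpa [S] using hz), x, by simpa [S] using hx, rfl⟩
  choose a ha ha' using hlow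
  have hsplit : ∀ (f : I → ℕ) (k : ℕ), ∑ i, ((if i ∈ C then f i else 0) +
      if i = i₀ then k else 0) = ∑ i ∈ C, f i + k := by
    intro f k
    rw [Finset.sum_add_distrib, hsingle, Finset.sum_ite_mem, Finset.univ_inter]
  have hbig : m < ∑ i ∈ C, (a i + 1) := by
    by_contra! hsmall
    obtain ⟨i, hi, hle⟩ := hdomT _ ((hsplit (fun i => a i + 1) (m - ∑ i ∈ C, (a i + 1))).trans
      (by omega))
    obtain ⟨x, hx, hxa⟩ := ha' i
    have := hle x hx
    simp only [hi, if_true] at this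
    omega
  rw [Finset.sum_add_distrib, ← Finset.card_eq_sum_ones] at hbig
  have hCcard : C.card ≤ Fintype.card I := Finset.card_le_univ C
  have hxC : ∀ x : T, ∑ i ∈ C, x.1 i + ∑ i ∈ Cᶜ, x.1 i = m := fun x => by
    rw [Finset.sum_add_sum_compl, hTsum]
  have hasum : ∑ i ∈ C, a i ≤ m := by
    obtain ⟨x, hx⟩ := hS
    have h1 := hxC x
    have h2 : ∑ i ∈ C, a i ≤ ∑ i ∈ C, x.1 i :=
      Finset.sum_le_sum fun i _ => ha i x (by simpa [S] using hx)
    omega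
  refine ⟨C, _, (hsplit a (m - ∑ i ∈ C, a i)).trans (by omega), fun i hi => ?_, fun i hi => ?_⟩
  · have : i ≠ i₀ := fun h => hi (h ▸ hi₀)
    simp [hi, this]
  · obtain ⟨x, hx, hxi⟩ := hcol i hi
    refine ⟨x.1, hTsum x, hxi, fun j => ?_⟩
    have h1 := hxC x
    by_cases hj : j ∈ C
    · have h2 := Finset.add_sum_erase C (fun i => x.1 i) hj
      have h3 := Finset.add_sum_erase C a hj
      have h4 : ∑ i ∈ C.erase j, a i ≤ ∑ i ∈ C.erase j, x.1 i :=
        Finset.sum_le_sum fun i _ => ha i x hx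
      have h5 := ha j x hx
      simp only [hj, if_true]
      split_ifs <;> omega
    · have hji : j ≠ i₀ := fun h => hj (h ▸ hi₀)
      have h2 : ∑ i ∈ C, a i ≤ ∑ i ∈ C, x.1 i := Finset.sum_le_sum fun i _ => ha i x hx
      have h3 : x.1 j ≤ ∑ i ∈ Cᶜ, x.1 i :=
        Finset.single_le_sum (f := fun i => x.1 i) (fun _ _ => Nat.zero_le _) (by simpa using hj)
      simp only [hj, hji, if_false]
      omega

/-- **Knaster–Kuratowski–Mazurkiewicz lemma**: if the closed sets `F i` are such that every point
of the standard simplex lies in `F i` for some `i` in its support, then they have a common point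
in the simplex. -/
theorem exists_mem_stdSimplex_forall_mem {I : Type*} [Fintype I] [Nonempty I]
    {F : I → Set (I → ℝ)} (hF : ∀ i, IsClosed (F i))
    (hcov : ∀ x ∈ stdSimplex ℝ I, ∃ i, 0 < x i ∧ x ∈ F i) :
    ∃ x ∈ stdSimplex ℝ I, ∀ i, x ∈ F i := by
  classical
  by_contra! hno
  obtain ⟨δ, hδ, hball⟩ := lebesgue_number_lemma_of_metric (isCompact_stdSimplex ℝ I)
    (fun i => (hF i).isOpen_compl) (fun x hx => by simpa using hno x hx)
  obtain ⟨m, hm⟩ := exists_nat_gt ((Fintype.card I : ℝ) / δ)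
  have hm0 : (0 : ℝ) < m := lt_of_le_of_lt (by positivity) hm
  have hmδ : (Fintype.card I : ℝ) / m < δ := by
    rw [div_lt_iff₀ hδ] at hm
    rw [div_lt_iff₀ hm0]
    linarith
  let p : (I → ℕ) → I → ℝ := fun x i => x i / m
  have hp : ∀ x : I → ℕ, ∑ i, x i = m → p x ∈ stdSimplex ℝ I := by
    refine fun x hx => ⟨fun i => by positivity, ?_⟩
    simp only [p]
    rw [← Finset.sum_div, ← Nat.cast_sum, hx, div_self hm0.ne']
  have hc : ∀ x : I → ℕ, ∃ i, ∑ i, x i = m → Metric.ball (p x) δ ⊆ (F i)ᶜ := by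
    intro x
    by_cases hx : ∑ i, x i = m
    · obtain ⟨i, hi⟩ := hball _ (hp x hx)
      exact ⟨i, fun _ => hi⟩
    · exact ⟨Classical.arbitrary I, fun h => absurd h hx⟩
  choose c hc using hc
  obtain ⟨C, y, hy, hyC, hnear⟩ := exists_lattice_point_near_colors m c
  obtain ⟨i, hi, hiF⟩ := hcov _ (hp y hy)
  have hiC : i ∈ C := by
    by_contra h
    simp [p, hyC i h] at hi
  obtain ⟨x, hx, rfl, hxy⟩ := hnear i hiC
  refine hc x hx ?_ hiF
  rw [Metric.mem_ball, dist_pi_lt_iff hδ]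
  intro j
  refine lt_of_le_of_lt ?_ hmδ
  rw [Real.dist_eq, ← sub_div, abs_div, abs_of_pos hm0]
  gcongr
  have h1 : (x j : ℝ) ≤ y j + Fintype.card I := mod_cast (hxy j).1
  have h2 : (y j : ℝ) ≤ x j + Fintype.card I := mod_cast (hxy j).2
  rw [abs_le]
  constructor <;> linarith

/-- The probability measure putting mass `x i` at the point `ω i`. -/
noncomputable def weightedDirac {I Ω : Type*} [Fintype I] [MeasurableSpace Ω] (ω : I → Ω)
    (x : stdSimplex ℝ I) : ProbabilityMeasure Ω :=
  ⟨∑ i, ENNReal.ofReal (x.1 i) • Measure.dirac (ω i), ⟨by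
    simp only [Measure.coe_finsetSum, Finset.sum_apply, Measure.smul_apply, measure_univ,
      smul_eq_mul, mul_one]
    rw [← ENNReal.ofReal_sum_of_nonneg fun i _ => x.2.1 i, x.2.2, ENNReal.ofReal_one]⟩⟩

theorem continuous_weightedDirac {I Ω : Type*} [Fintype I] [MeasurableSpace Ω]
    [TopologicalSpace Ω] [OpensMeasurableSpace Ω] (ω : I → Ω) :
    Continuous (weightedDirac ω) := by
  have hint : ∀ (f : BoundedContinuousFunction Ω ℝ) (x : stdSimplex ℝ I),
      ∫ a, f a ∂(weightedDirac ω x : Measure Ω) = ∑ i, x.1 i * f (ω i) := by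
    intro f x
    have hm := f.continuous.stronglyMeasurable
    change ∫ a, f a ∂(∑ i, ENNReal.ofReal (x.1 i) • Measure.dirac (ω i)) = _
    rw [integral_finsetSum_measure fun i _ =>
      (f.integrable (Measure.dirac (ω i))).smul_measure ENNReal.ofReal_ne_top]
    refine Finset.sum_congr rfl fun i _ => ?_
    rw [integral_smul_measure, integral_dirac' _ _ hm, ENNReal.toReal_ofReal (x.2.1 i),
      smul_eq_mul]
  rw [continuous_iff_continuousAt]
  intro x
  refine ProbabilityMeasure.tendsto_iff_forall_integral_tendsto.2 fun f => ?_
  simp only [hint]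
  have : Continuous fun x : stdSimplex ℝ I => ∑ i, x.1 i * f (ω i) :=
    continuous_finsetSum _ fun i _ =>
      ((continuous_apply i).comp continuous_subtype_val).mul continuous_const
  exact this.tendsto x

theorem lintegral_weightedDirac {I Ω : Type*} [Fintype I] [MeasurableSpace Ω]
    [MeasurableSingletonClass Ω] (ω : I → Ω) (x : stdSimplex ℝ I) (f : Ω → ℝ≥0∞) :
    ∫⁻ a, f a ∂(weightedDirac ω x : Measure Ω) = ∑ i, ENNReal.ofReal (x.1 i) * f (ω i) := by
  change ∫⁻ a, f a ∂(∑ i, ENNReal.ofReal (x.1 i) • Measure.dirac (ω i)) = _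
  simp [lintegral_smul_measure, lintegral_dirac]

/-- On finitely many points, a lower semicontinuous test has a neutral measure. -/
theorem exists_forall_finset_le_one {Ω : Type*} [MeasurableSpace Ω] [TopologicalSpace Ω]
    [OpensMeasurableSpace Ω] [MeasurableSingletonClass Ω]
    {t : Ω × ProbabilityMeasure Ω → ℝ≥0∞} (ht : LowerSemicontinuous t)
    (hint : ∀ P : ProbabilityMeasure Ω, ∫⁻ ω, t (ω, P) ∂(P : Measure Ω) ≤ 1)
    {u : Finset Ω} (hu : u.Nonempty) :
    ∃ P : ProbabilityMeasure Ω, ∀ ω ∈ u, t (ω, P) ≤ 1 := by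
  have : Nonempty u := hu.to_subtype
  let G : u → Set (stdSimplex ℝ u) := fun i => {x | t (i.1, weightedDirac Subtype.val x) ≤ 1}
  have hG : ∀ i, IsClosed (G i) := fun i =>
    (ht.isClosed_preimage 1).preimage
      (continuous_const.prodMk (continuous_weightedDirac Subtype.val))
  obtain ⟨x, hx, hxF⟩ := exists_mem_stdSimplex_forall_mem (F := fun i => Subtype.val '' G i)
    (fun i => (isClosed_stdSimplex ℝ u).isClosedEmbedding_subtypeVal.isClosedMap _ (hG i)) (by
      intro x hx
      by_contra! hno
      have hgt : ∀ i, 0 < x i → 1 < t (i.1, weightedDirac Subtype.val ⟨x, hx⟩) :=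
        fun i hi => not_le.1 fun h => hno i hi ⟨⟨x, hx⟩, h, rfl⟩
      have hle := hint (weightedDirac Subtype.val ⟨x, hx⟩)
      rw [lintegral_weightedDirac] at hle
      have hsum : ∑ i, ENNReal.ofReal (x i) = 1 := by
        rw [← ENNReal.ofReal_sum_of_nonneg fun i _ => hx.1 i, hx.2, ENNReal.ofReal_one]
      obtain ⟨i, -, hi⟩ := Finset.exists_lt_of_sum_lt (s := Finset.univ)
        (f := fun _ : u => (0 : ℝ)) (g := x) (by rw [hx.2]; simp)
      refine absurd hle (not_le.2 ?_)
      rw [← hsum, ← Finset.sum_filter_of_ne (p := fun i => 0 < x i) fun i _ h =>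
        ENNReal.ofReal_pos.1 (pos_iff_ne_zero.2 h)]
      refine (ENNReal.sum_lt_sum_of_nonempty ⟨i, by simpa using hi⟩ fun j hj => ?_).trans_le
        (Finset.sum_le_sum_of_subset (Finset.filter_subset _ _))
      have hj : 0 < x j := (Finset.mem_filter.1 hj).2
      conv_lhs => rw [← mul_one (ENNReal.ofReal (x j))]
      exact ENNReal.mul_lt_mul_right (ENNReal.ofReal_pos.2 hj).ne' ENNReal.ofReal_ne_top (hgt j hj))
  refine ⟨weightedDirac Subtype.val ⟨x, hx⟩, fun ω hω => ?_⟩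
  obtain ⟨x', hx', rfl⟩ := hxF ⟨ω, hω⟩
  exact hx'

/-- Existence of a neutral measure: if `t : Ω × M(Ω) → [0,∞]` is lower
semicontinuous and `∫ t(ω,P) dP(ω) ≤ 1` for every Borel probability measure `P`
on the Cantor space `Ω = ℕ → Bool`, then there is a probability measure `N`
with `t(ω,N) ≤ 1` for all `ω`. -/
theorem neutral_measure
    (t : (ℕ → Bool) × ProbabilityMeasure (ℕ → Bool) → ℝ≥0∞)
    (ht : LowerSemicontinuous t)
    (hint : ∀ P : ProbabilityMeasure (ℕ → Bool),
      ∫⁻ ω, t (ω, P) ∂(P : Measure (ℕ → Bool)) ≤ 1) :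
    ∃ N : ProbabilityMeasure (ℕ → Bool), ∀ ω : ℕ → Bool, t (ω, N) ≤ 1 := by
  have hcl : ∀ ω, IsClosed {P : ProbabilityMeasure (ℕ → Bool) | t (ω, P) ≤ 1} := fun ω =>
    (ht.isClosed_preimage 1).preimage (continuous_const.prodMk continuous_id)
  obtain ⟨N, -, hN⟩ := isCompact_univ.inter_iInter_nonempty _ hcl fun u => by
    obtain rfl | hu := u.eq_empty_or_nonempty
    · exact ⟨⟨Measure.dirac fun _ => false, inferInstance⟩, Set.mem_univ _,
        Set.mem_iInter₂.2 fun _ h => absurd h (Finset.notMem_empty _)⟩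
    · obtain ⟨P, hP⟩ := exists_forall_finset_le_one ht hint hu
      exact ⟨P, by simpa using hP⟩
  exact ⟨N, by simpa using hN⟩
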